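/- Let u, v : ℝ × ℝ → ℝ be smooth functions of (x,t) solving the generalized Riemann equation at N=2, i.e. u_t = 2u·u_x − 2v and v_t = 2u·v_x. Then at every point (x,t): ∂_t(2t·u_x·v + v) = ∂_x(t·(4u·u_x·v − 2v²) + 2u·v). -/

import Mathlib

/-- Partial derivative with respect to the first variable `x`. -/
noncomputable def pdx (f : ℝ × ℝ → ℝ) (p : ℝ × ℝ) : ℝ := deriv (fun x => f (x, p.2)) p.1

/-- Partial derivative with respect to the second variable `t`. -/
noncomputable def pdt (f : ℝ × ℝ → ℝ) (p : ℝ × ℝ) : ℝ := deriv (fun t => f (p.1, t)) p.2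

theorem hasDerivAt_slice_fst {f : ℝ × ℝ → ℝ} {p : ℝ × ℝ} (hf : DifferentiableAt ℝ f p) :
    HasDerivAt (fun x => f (x, p.2)) (fderiv ℝ f p (1, 0)) p.1 :=
  HasFDerivAt.comp_hasDerivAt (f := fun x : ℝ => (x, p.2)) p.1 hf.hasFDerivAt
    ((hasDerivAt_id p.1).prodMk (hasDerivAt_const p.1 p.2))

theorem hasDerivAt_slice_snd {f : ℝ × ℝ → ℝ} {p : ℝ × ℝ} (hf : DifferentiableAt ℝ f p) :
    HasDerivAt (fun t => f (p.1, t)) (fderiv ℝ f p (0, 1)) p.2 :=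
  HasFDerivAt.comp_hasDerivAt (f := fun t : ℝ => (p.1, t)) p.2 hf.hasFDerivAt
    ((hasDerivAt_const p.2 p.1).prodMk (hasDerivAt_id p.2))

theorem pdx_eq_fderiv {f : ℝ × ℝ → ℝ} (hf : Differentiable ℝ f) :
    pdx f = fun p => fderiv ℝ f p (1, 0) :=
  funext fun p => (hasDerivAt_slice_fst (hf p)).deriv

theorem pdt_eq_fderiv {f : ℝ × ℝ → ℝ} (hf : Differentiable ℝ f) :
    pdt f = fun p => fderiv ℝ f p (0, 1) :=
  funext fun p => (hasDerivAt_slice_snd (hf p)).deriv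

theorem hasDerivAt_pdx {f : ℝ × ℝ → ℝ} (hf : Differentiable ℝ f) (p : ℝ × ℝ) :
    HasDerivAt (fun x => f (x, p.2)) (pdx f p) p.1 :=
  (hasDerivAt_slice_fst (hf p)).differentiableAt.hasDerivAt

theorem hasDerivAt_pdt {f : ℝ × ℝ → ℝ} (hf : Differentiable ℝ f) (p : ℝ × ℝ) :
    HasDerivAt (fun t => f (p.1, t)) (pdt f p) p.2 :=
  (hasDerivAt_slice_snd (hf p)).differentiableAt.hasDerivAt

theorem differentiable_fderiv_of_contDiff_two {f : ℝ × ℝ → ℝ} (hf : ContDiff ℝ 2 f) :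
    Differentiable ℝ (fderiv ℝ f) :=
  (hf.fderiv_right (m := 1) (by norm_num)).differentiable (by norm_num)

theorem differentiable_pdx {f : ℝ × ℝ → ℝ} (hf : ContDiff ℝ 2 f) : Differentiable ℝ (pdx f) := by
  rw [pdx_eq_fderiv (hf.differentiable (by norm_num))]
  exact (differentiable_fderiv_of_contDiff_two hf).clm_apply (differentiable_const _)

theorem differentiable_pdt {f : ℝ × ℝ → ℝ} (hf : ContDiff ℝ 2 f) : Differentiable ℝ (pdt f) := by
  rw [pdt_eq_fderiv (hf.differentiable (by norm_num))]
  exact (differentiable_fderiv_of_contDiff_two hf).clm_apply (differentiable_const _)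

/-- Mixed partial derivatives of a `C²` function commute. -/
theorem pdt_pdx_comm {f : ℝ × ℝ → ℝ} (hf : ContDiff ℝ 2 f) (p : ℝ × ℝ) :
    pdt (pdx f) p = pdx (pdt f) p := by
  have hd : Differentiable ℝ f := hf.differentiable (by norm_num)
  have h2 := differentiable_fderiv_of_contDiff_two hf
  rw [pdt_eq_fderiv (differentiable_pdx hf), pdx_eq_fderiv (differentiable_pdt hf),
    pdx_eq_fderiv hd, pdt_eq_fderiv hd]
  have key (a b : ℝ × ℝ) :
      fderiv ℝ (fun q => fderiv ℝ f q a) p b = fderiv ℝ (fderiv ℝ f) p b a := by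
    rw [fderiv_clm_apply (h2 p) (differentiableAt_const a)]
    simp
  simp only [key]
  exact (hf.contDiffAt.isSymmSndFDerivAt (by simp)) _ _

theorem riemannN2_time_dependent_conservation_law_1 (u v : ℝ × ℝ → ℝ)
    (hu : ContDiff ℝ (⊤ : ℕ∞) u) (hv : ContDiff ℝ (⊤ : ℕ∞) v)
    (hequ : ∀ p : ℝ × ℝ, pdt u p = 2 * u p * pdx u p - 2 * v p)
    (heqv : ∀ p : ℝ × ℝ, pdt v p = 2 * u p * pdx v p) :
    ∀ p : ℝ × ℝ,
      pdt (fun q => 2 * q.2 * pdx u q * v q + v q) p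
        = pdx (fun q => q.2 * (4 * u q * pdx u q * v q - 2 * (v q) ^ 2) + 2 * u q * v q) p := by
  intro p
  have hu2 : ContDiff ℝ 2 u := contDiff_infty.1 hu 2
  have hud : Differentiable ℝ u := hu2.differentiable (by norm_num)
  have hvd : Differentiable ℝ v := hv.differentiable (by simp)
  have hw := differentiable_pdx hu2
  have ux := hasDerivAt_pdx hud p
  have vx := hasDerivAt_pdx hvd p
  have wx := hasDerivAt_pdx hw p
  have vt := hasDerivAt_pdt hvd p
  have wt := hasDerivAt_pdt hw p
  have mixed : pdt (pdx u) p
      = 2 * pdx u p * pdx u p + 2 * u p * pdx (pdx u) p - 2 * pdx v p := by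
    rw [pdt_pdx_comm hu2, funext hequ]
    exact (((ux.const_mul 2).mul wx).sub (vx.const_mul 2)).deriv
  have lhs : pdt (fun q => 2 * q.2 * pdx u q * v q + v q) p
      = (2 * 1 * pdx u p + 2 * p.2 * pdt (pdx u) p) * v p
        + 2 * p.2 * pdx u p * pdt v p + pdt v p :=
    (((((hasDerivAt_id p.2).const_mul 2).mul wt).mul vt).add vt).deriv
  have rhs : pdx (fun q => q.2 * (4 * u q * pdx u q * v q - 2 * (v q) ^ 2) + 2 * u q * v q) p
      = p.2 * (((4 * pdx u p * pdx u p + 4 * u p * pdx (pdx u) p) * v p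
          + 4 * u p * pdx u p * pdx v p) - 2 * ((2 : ℕ) * v p ^ (2 - 1) * pdx v p))
        + (2 * pdx u p * v p + 2 * u p * pdx v p) :=
    ((((((ux.const_mul 4).mul wx).mul vx).sub ((vx.pow 2).const_mul 2)).const_mul p.2).add
      ((ux.const_mul 2).mul vx)).deriv
  rw [lhs, rhs, mixed, heqv]
  norm_num
  ring
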